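/- Let g : [a,b] → ℝ be nondecreasing and continuous, let φ : [a,b] → ℝⁿ be continuous, and let u : [a,b] → ℝⁿ be given by u(t) = ∫_a^t φ(s) dg(s) (the Kurzweil–Stieltjes integral, which exists for every t ∈ [a,b]). If g is differentiable at a point t ∈ [a,b], then u is differentiable at t and u′(t) = φ(t) g′(t). -/

import Mathlib

open Set Filter Topology

namespace HMDEPaper

/-- `ℝⁿ` with the Euclidean norm. -/
abbrev En (n : ℕ) := EuclideanSpace ℝ (Fin n)

section Defs

variable {E : Type*} [NormedAddCommGroup E]

/-- `f` is regulated on the interval `[a, b]`: one-sided limits exist at every point. -/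
def RegulatedOn (f : ℝ → E) (a b : ℝ) : Prop :=
  (∀ t ∈ Set.Ioc a b, ∃ L, Filter.Tendsto f (nhdsWithin t (Set.Ico a t)) (nhds L)) ∧
  (∀ t ∈ Set.Ico a b, ∃ L, Filter.Tendsto f (nhdsWithin t (Set.Ioc t b)) (nhds L))

/-- `f` is regulated on `[0, ∞)`: one-sided limits exist at every point. -/
def RegulatedOnIci (f : ℝ → E) : Prop :=
  (∀ t : ℝ, 0 < t → ∃ L, Filter.Tendsto f (nhdsWithin t (Set.Ico 0 t)) (nhds L)) ∧
  (∀ t : ℝ, 0 ≤ t → ∃ L, Filter.Tendsto f (nhdsWithin t (Set.Ioi t)) (nhds L))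

/-- A family `F` of functions is equiregulated on `[a, b]`. -/
def EquiregulatedOn (F : Set (ℝ → E)) (a b : ℝ) : Prop :=
  ∀ ε : ℝ, 0 < ε →
    (∀ τ ∈ Set.Ioc a b, ∃ δ > (0 : ℝ), ∀ y ∈ F, ∀ L,
      Filter.Tendsto y (nhdsWithin τ (Set.Ico a τ)) (nhds L) →
      ∀ t ∈ Set.Ico a τ, τ - δ < t → ‖y t - L‖ < ε) ∧
    (∀ τ ∈ Set.Ico a b, ∃ δ > (0 : ℝ), ∀ y ∈ F, ∀ L,
      Filter.Tendsto y (nhdsWithin τ (Set.Ioc τ b)) (nhds L) →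
      ∀ t ∈ Set.Ioc τ b, t < τ + δ → ‖y t - L‖ < ε)

/-- A D-function: continuous, nondecreasing on `[0, ∞)`, vanishing at `0`, positive on `(0, ∞)`. -/
def IsDFunction (φ : ℝ → ℝ) : Prop :=
  ContinuousOn φ (Set.Ici 0) ∧ MonotoneOn φ (Set.Ici 0) ∧ φ 0 = 0 ∧
    ∀ s : ℝ, 0 < s → 0 < φ s

/-- `g` is left-continuous at every point of `(a, b]`. -/
def LeftContinuousOn (g : ℝ → ℝ) (a b : ℝ) : Prop :=
  ∀ t ∈ Set.Ioc a b, Filter.Tendsto g (nhdsWithin t (Set.Ico a t)) (nhds (g t))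

/-- A bounded regulated function on `[0, ∞)` which is S-asymptotically `ω`-periodic. -/
def SAsympPeriodic (ω : ℝ) (x : ℝ → E) : Prop :=
  (∃ C : ℝ, ∀ t : ℝ, 0 ≤ t → ‖x t‖ ≤ C) ∧ RegulatedOnIci x ∧
    Filter.Tendsto (fun t => x (t + ω) - x t) Filter.atTop (nhds 0)

end Defs

section KS

/-- A tagged partition of `[a, b]`. -/
structure TaggedPartition (a b : ℝ) where
  n : ℕ
  npos : 0 < n
  s : ℕ → ℝ
  τ : ℕ → ℝ
  s_first : s 0 = a
  s_last : s n = b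
  s_mono : ∀ i < n, s i ≤ s (i + 1)
  tag_mem : ∀ i < n, τ i ∈ Set.Icc (s i) (s (i + 1))

/-- A tagged partition is `δ`-fine for a gauge `δ`. -/
def TaggedPartition.IsFine {a b : ℝ} (P : TaggedPartition a b) (δ : ℝ → ℝ) : Prop :=
  ∀ i < P.n,
    Set.Icc (P.s i) (P.s (i + 1)) ⊆ Set.Ioo (P.τ i - δ (P.τ i)) (P.τ i + δ (P.τ i))

variable {E : Type*} [NormedAddCommGroup E] [NormedSpace ℝ E]

/-- The Kurzweil–Stieltjes Riemann sum of `f` w.r.t. `g` over a tagged partition. -/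
def TaggedPartition.sum {a b : ℝ} (P : TaggedPartition a b) (f : ℝ → E) (g : ℝ → ℝ) : E :=
  ∑ i ∈ Finset.range P.n, (g (P.s (i + 1)) - g (P.s i)) • f (P.τ i)

/-- `I` is the Kurzweil–Stieltjes integral of `f` w.r.t. `g` over `[a, b]`. -/
def HasKSIntegral (f : ℝ → E) (g : ℝ → ℝ) (a b : ℝ) (I : E) : Prop :=
  ∀ ε : ℝ, 0 < ε → ∃ δ : ℝ → ℝ, (∀ t, 0 < δ t) ∧
    ∀ P : TaggedPartition a b, P.IsFine δ → ‖P.sum f g - I‖ < ε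

/-- `f` is Kurzweil–Stieltjes integrable w.r.t. `g` over `[a, b]`. -/
def KSIntegrable (f : ℝ → E) (g : ℝ → ℝ) (a b : ℝ) : Prop :=
  ∃ I, HasKSIntegral f g a b I

/-- A solution of the hybrid measure differential equation on `[t₀, t₀ + a]`
with data `(h, f, g, x₀)`. -/
def IsHMDESolution (h f : ℝ → E → E) (g : ℝ → ℝ) (t₀ a : ℝ) (x₀ : E) (x : ℝ → E) : Prop :=
  RegulatedOn x t₀ (t₀ + a) ∧ x t₀ = x₀ ∧
  RegulatedOn (fun t => h t (x t)) t₀ (t₀ + a) ∧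
  ∃ I : ℝ → E,
    (∀ t ∈ Set.Icc t₀ (t₀ + a), HasKSIntegral (fun s => f s (x s)) g t₀ t (I t)) ∧
    (∀ t ∈ Set.Icc t₀ (t₀ + a), x t = x₀ - h t₀ x₀ + h t (x t) + I t)

end KS

end HMDEPaper

namespace HMDEPaper

namespace TaggedPartition

variable {x y z : ℝ}

/-- The partition of `[x, y]` into a single piece with tag `c`. -/
def single (c : ℝ) (hc : c ∈ Set.Icc x y) : TaggedPartition x y where
  n := 1
  npos := one_pos
  s i := if i = 0 then x else y
  τ _ := c
  s_first := by simp
  s_last := by simp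
  s_mono i hi := by
    obtain rfl : i = 0 := by omega
    simpa using hc.1.trans hc.2
  tag_mem i hi := by
    obtain rfl : i = 0 := by omega
    simpa using hc

theorem isFine_single {δ : ℝ → ℝ} {c : ℝ} (hc : c ∈ Set.Icc x y) (hx : c - δ c < x)
    (hy : y < c + δ c) : (single c hc).IsFine δ := by
  intro i hi
  obtain rfl : i = 0 := by simpa [single] using hi
  intro r hr
  simp only [single, if_true, zero_add, one_ne_zero, if_false] at hr ⊢
  exact ⟨hx.trans_le hr.1, hr.2.trans_lt hy⟩

/-- The division points of two partitions of adjacent intervals, put together. -/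
def appendPoints (P : TaggedPartition x y) (Q : TaggedPartition y z) (i : ℕ) : ℝ :=
  if i < P.n then P.s i else Q.s (i - P.n)

/-- The tags of two partitions of adjacent intervals, put together. -/
def appendTags (P : TaggedPartition x y) (Q : TaggedPartition y z) (i : ℕ) : ℝ :=
  if i < P.n then P.τ i else Q.τ (i - P.n)

theorem appendPoints_of_le (P : TaggedPartition x y) (Q : TaggedPartition y z) {i : ℕ}
    (hi : i ≤ P.n) : P.appendPoints Q i = P.s i := by
  rcases hi.lt_or_eq with h | rfl
  · simp [appendPoints, h]
  · simp [appendPoints, P.s_last, Q.s_first]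

theorem appendPoints_add (P : TaggedPartition x y) (Q : TaggedPartition y z) (i : ℕ) :
    P.appendPoints Q (P.n + i) = Q.s i := by
  simp [appendPoints]

theorem appendTags_of_lt (P : TaggedPartition x y) (Q : TaggedPartition y z) {i : ℕ}
    (hi : i < P.n) : P.appendTags Q i = P.τ i := by
  simp [appendTags, hi]

theorem appendTags_add (P : TaggedPartition x y) (Q : TaggedPartition y z) (i : ℕ) :
    P.appendTags Q (P.n + i) = Q.τ i := by
  simp [appendTags]

/-- A property of consecutive division points and their tag holds for the concatenation as soon
as it holds for both parts. -/
theorem append_forall (P : TaggedPartition x y) (Q : TaggedPartition y z)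
    {p : ℝ → ℝ → ℝ → Prop} (hP : ∀ i < P.n, p (P.s i) (P.s (i + 1)) (P.τ i))
    (hQ : ∀ i < Q.n, p (Q.s i) (Q.s (i + 1)) (Q.τ i)) (i : ℕ) (hi : i < P.n + Q.n) :
    p (P.appendPoints Q i) (P.appendPoints Q (i + 1)) (P.appendTags Q i) := by
  rcases lt_or_ge i P.n with h | h
  · rw [appendPoints_of_le P Q h.le, appendPoints_of_le P Q h, appendTags_of_lt P Q h]
    exact hP i h
  · obtain ⟨j, rfl⟩ := Nat.exists_eq_add_of_le h
    rw [add_assoc, appendPoints_add, appendPoints_add, appendTags_add]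
    exact hQ j (by omega)

/-- Concatenation of partitions of adjacent intervals. -/
def append (P : TaggedPartition x y) (Q : TaggedPartition y z) : TaggedPartition x z where
  n := P.n + Q.n
  npos := Nat.add_pos_left P.npos _
  s := P.appendPoints Q
  τ := P.appendTags Q
  s_first := by rw [appendPoints_of_le P Q (Nat.zero_le _), P.s_first]
  s_last := by rw [appendPoints_add, Q.s_last]
  s_mono := append_forall P Q (p := fun l r _ => l ≤ r) P.s_mono Q.s_mono
  tag_mem := append_forall P Q (p := fun l r c => c ∈ Set.Icc l r) P.tag_mem Q.tag_mem

theorem IsFine.append {δ : ℝ → ℝ} {P : TaggedPartition x y} {Q : TaggedPartition y z}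
    (hP : P.IsFine δ) (hQ : Q.IsFine δ) : (P.append Q).IsFine δ :=
  append_forall P Q (p := fun l r c => Set.Icc l r ⊆ Set.Ioo (c - δ c) (c + δ c)) hP hQ

theorem IsFine.mono {δ δ' : ℝ → ℝ} (h : ∀ r, δ r ≤ δ' r) {P : TaggedPartition x y}
    (hP : P.IsFine δ) : P.IsFine δ' := fun i hi =>
  (hP i hi).trans (Set.Ioo_subset_Ioo (by linarith [h (P.τ i)]) (by linarith [h (P.τ i)]))

/-- Cousin's lemma: fine partitions exist for every gauge. -/
theorem exists_isFine {δ : ℝ → ℝ} (hδ : ∀ r, 0 < δ r) (hxy : x ≤ y) :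
    ∃ P : TaggedPartition x y, P.IsFine δ := by
  set S : Set ℝ := {r | r ∈ Set.Icc x y ∧ ∃ P : TaggedPartition x r, P.IsFine δ}
  have hxS : x ∈ S := ⟨⟨le_rfl, hxy⟩, single x ⟨le_rfl, le_rfl⟩,
    isFine_single _ (by linarith [hδ x]) (by linarith [hδ x])⟩
  have hbdd : BddAbove S := ⟨y, fun r hr => hr.1.2⟩
  set c := sSup S
  obtain ⟨r, hrS, hr⟩ := exists_lt_of_lt_csSup ⟨x, hxS⟩ (sub_lt_self c (hδ c))
  have hrc : r ≤ c := le_csSup hbdd hrS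
  have hcy : c ≤ y := csSup_le ⟨x, hxS⟩ fun r hr => hr.1.2
  obtain ⟨⟨hxr, -⟩, P, hP⟩ := hrS
  set m := min y (c + δ c / 2)
  have hcm : c ≤ m := le_min hcy (by linarith [hδ c])
  have hmS : m ∈ S := ⟨⟨hxr.trans (hrc.trans hcm), min_le_left _ _⟩, _, hP.append
    (isFine_single ⟨hrc, hcm⟩ hr ((min_le_right _ _).trans_lt (by linarith [hδ c])))⟩
  have hmc : m ≤ c := le_csSup hbdd hmS
  have hmy : m = y := by
    rcases min_choice y (c + δ c / 2) with h | h
    · exact h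
    · linarith [hδ c]
  exact hmy ▸ hmS.2

theorem le_s (P : TaggedPartition x y) : ∀ i ≤ P.n, x ≤ P.s i
  | 0, _ => P.s_first.ge
  | i + 1, hi => (P.le_s i (by omega)).trans (P.s_mono i hi)

theorem s_le (P : TaggedPartition x y) {i : ℕ} (hi : i ≤ P.n) : P.s i ≤ y := by
  induction hi using Nat.decreasingInduction with
  | self => exact P.s_last.le
  | of_succ k hk ih => exact (P.s_mono k hk).trans ih

theorem tag_mem_Icc (P : TaggedPartition x y) {i : ℕ} (hi : i < P.n) : P.τ i ∈ Set.Icc x y :=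
  ⟨(P.le_s i hi.le).trans (P.tag_mem i hi).1, (P.tag_mem i hi).2.trans (P.s_le hi)⟩

variable {E : Type*} [NormedAddCommGroup E] [NormedSpace ℝ E]

theorem sum_append (P : TaggedPartition x y) (Q : TaggedPartition y z) (f : ℝ → E)
    (g : ℝ → ℝ) : (P.append Q).sum f g = P.sum f g + Q.sum f g := by
  simp only [sum, append, Finset.sum_range_add, add_assoc, appendPoints_add, appendTags_add]
  congr 1
  refine Finset.sum_congr rfl fun i hi => ?_
  have hi := Finset.mem_range.1 hi
  rw [appendPoints_of_le P Q hi.le, appendPoints_of_le P Q hi, appendTags_of_lt P Q hi]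

theorem norm_sum_sub_le (P : TaggedPartition x y) {f : ℝ → E} {g : ℝ → ℝ}
    (hg : MonotoneOn g (Set.Icc x y)) {v : E} {ε : ℝ}
    (hf : ∀ r ∈ Set.Icc x y, ‖f r - v‖ ≤ ε) :
    ‖P.sum f g - (g y - g x) • v‖ ≤ ε * (g y - g x) := by
  have htel : g y - g x = ∑ i ∈ Finset.range P.n, (g (P.s (i + 1)) - g (P.s i)) := by
    rw [Finset.sum_range_sub (fun i => g (P.s i)), P.s_first, P.s_last]
  rw [htel, Finset.sum_smul, sum, ← Finset.sum_sub_distrib, Finset.mul_sum]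
  refine norm_sum_le_of_le _ fun i hi => ?_
  have hi := Finset.mem_range.1 hi
  have hmono : 0 ≤ g (P.s (i + 1)) - g (P.s i) := sub_nonneg.2 <|
    hg ⟨P.le_s i hi.le, P.s_le hi.le⟩ ⟨P.le_s _ hi, P.s_le hi⟩ (P.s_mono i hi)
  rw [← smul_sub, norm_smul, Real.norm_of_nonneg hmono, mul_comm]
  exact mul_le_mul_of_nonneg_right (hf _ (P.tag_mem_Icc hi)) hmono

end TaggedPartition

/-- The increment of the integral over `[x, y]` is close to `(g y - g x) • v` when the integrand
is close to `v` on `[x, y]`. -/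
theorem HasKSIntegral.norm_sub_sub_smul_le {E : Type*} [NormedAddCommGroup E] [NormedSpace ℝ E]
    {f : ℝ → E} {g : ℝ → ℝ} {a x y : ℝ} {I J : E} (hI : HasKSIntegral f g a x I)
    (hJ : HasKSIntegral f g a y J) (hax : a ≤ x) (hxy : x ≤ y)
    (hg : MonotoneOn g (Set.Icc x y)) {v : E} {ε : ℝ}
    (hf : ∀ r ∈ Set.Icc x y, ‖f r - v‖ ≤ ε) :
    ‖J - I - (g y - g x) • v‖ ≤ ε * (g y - g x) := by
  refine le_of_forall_pos_le_add fun η hη => ?_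
  obtain ⟨δ₁, hδ₁, h₁⟩ := hI (η / 2) (half_pos hη)
  obtain ⟨δ₂, hδ₂, h₂⟩ := hJ (η / 2) (half_pos hη)
  have hδ : ∀ r, 0 < min (δ₁ r) (δ₂ r) := fun r => lt_min (hδ₁ r) (hδ₂ r)
  obtain ⟨P, hP⟩ := TaggedPartition.exists_isFine hδ hax
  obtain ⟨Q, hQ⟩ := TaggedPartition.exists_isFine hδ hxy
  have hPI := h₁ P (hP.mono fun r => min_le_left _ _)
  have hPQJ := h₂ (P.append Q) ((hP.append hQ).mono fun r => min_le_right _ _)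
  rw [TaggedPartition.sum_append] at hPQJ
  have hQv := Q.norm_sum_sub_le hg hf
  calc ‖J - I - (g y - g x) • v‖
      = ‖(Q.sum f g - (g y - g x) • v) + (P.sum f g - I) - (P.sum f g + Q.sum f g - J)‖ := by
        congr 1; abel
    _ ≤ ‖Q.sum f g - (g y - g x) • v‖ + ‖P.sum f g - I‖ + ‖P.sum f g + Q.sum f g - J‖ :=
        (norm_sub_le _ _).trans (by gcongr; exact norm_add_le _ _)
    _ ≤ ε * (g y - g x) + η := by linarith

/-- differentiation of the KS integral `u(t) = ∫_a^t φ dg` at points where `g`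
is differentiable, for continuous `φ` and continuous nondecreasing `g`. -/
theorem deriv_of_ks_integral
    {n : ℕ} (a b : ℝ) (hab : a ≤ b)
    (g : ℝ → ℝ) (hg_mono : MonotoneOn g (Set.Icc a b))
    (hg_cont : ContinuousOn g (Set.Icc a b))
    (φ : ℝ → En n) (hφ : ContinuousOn φ (Set.Icc a b))
    (u : ℝ → En n)
    (hu : ∀ t ∈ Set.Icc a b, HasKSIntegral φ g a t (u t))
    (t : ℝ) (ht : t ∈ Set.Icc a b)
    (d : ℝ) (hd : HasDerivWithinAt g d (Set.Icc a b) t) :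
    HasDerivWithinAt u (d • φ t) (Set.Icc a b) t := by
  have hsmall : (fun x => u x - u t - (g x - g t) • φ t)
      =o[𝓝[Set.Icc a b] t] fun x => g x - g t := by
    refine Asymptotics.isLittleO_iff.2 fun ε hε => ?_
    obtain ⟨r, hr, hφr⟩ := Metric.continuousWithinAt_iff.1 (hφ t ht) ε hε
    filter_upwards [self_mem_nhdsWithin,
      mem_nhdsWithin_of_mem_nhds (Metric.ball_mem_nhds t hr)] with x hx hxr
    have hclose : ∀ q ∈ Set.uIcc t x, ‖φ q - φ t‖ ≤ ε := fun q hq => by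
      rw [← dist_eq_norm]
      refine (hφr (Set.uIcc_subset_Icc ht hx hq) ?_).le
      rw [dist_comm]
      exact (Real.dist_left_le_of_mem_uIcc hq).trans_lt ((dist_comm _ _).trans_lt hxr)
    rcases le_total t x with htx | hxt
    · rw [Real.norm_of_nonneg (sub_nonneg.2 (hg_mono ht hx htx))]
      rw [Set.uIcc_of_le htx] at hclose
      exact (hu t ht).norm_sub_sub_smul_le (hu x hx) ht.1 htx
        (hg_mono.mono (Set.Icc_subset_Icc ht.1 hx.2)) hclose
    · rw [norm_sub_rev (g x), Real.norm_of_nonneg (sub_nonneg.2 (hg_mono hx ht hxt)),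
        ← norm_neg]
      rw [Set.uIcc_of_ge hxt] at hclose
      rw [show -(u x - u t - (g x - g t) • φ t) = u t - u x - (g t - g x) • φ t by module]
      exact (hu x hx).norm_sub_sub_smul_le (hu t ht) hx.1 hxt
        (hg_mono.mono (Set.Icc_subset_Icc hx.1 ht.2)) hclose
  have hgO : (fun x => g x - g t) =O[𝓝[Set.Icc a b] t] fun x => x - t :=
    hd.hasFDerivWithinAt.isBigO_sub
  rw [hasDerivWithinAt_iff_isLittleO] at hd ⊢
  have hlin : (fun x => (g x - g t - (x - t) • d) • φ t)
      =o[𝓝[Set.Icc a b] t] fun x => x - t := by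
    simpa using hd.smul_isBigO (Asymptotics.isBigO_const_const (φ t) (one_ne_zero (α := ℝ)) _)
  refine ((hsmall.trans_isBigO hgO).add hlin).congr_left fun x => ?_
  simp only [smul_eq_mul]
  module

end HMDEPaper
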